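/- The spherical cap discrepancy of a finite sample equals the maximum of finitely many explicitly computable local discrepancies: Δ = max{Δ₁, Δ₀}, where Δ₁ = max over index sets I in Φ₁ of max{Δ(w_I,t_I), Δ(−w_I,−t_I)} with t_I = ((1−γ_I)/γ_I)^{1/2} and w_I = ((1+t_I²)/t_I)·X_I(X̃_Iᵀ X̃_I)^{-1}1, and Δ₀ = max over I in Φ₀ of max{Δ(w_I,0), Δ(−w_I,0)} with w_I an arbitrary element of Ker(X_Iᵀ) ∩ S^{n-1} (the value being independent of this choice); here Φ₁ = {I : 1 ≤ rank X̃_I = #I ≤ min{n, rank X̃}, γ_I < 1} and Φ₀ = {I : 1 ≤ rank X̃_I = #I = min{n, rank X̃}, γ_I = 1} with γ_I = 1ᵀ(X̃_Iᵀ X̃_I)^{-1}1, and maxima over empty families are set to 0. -/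

import Mathlib

open scoped Classical BigOperators

noncomputable def muEmp {n N : ℕ} (x : Fin N → (Fin n → ℝ)) (w : Fin n → ℝ) (t : ℝ) : ℝ :=
  (Finset.univ.filter fun i => t ≤ ∑ j, w j * x i j).card / N

noncomputable def muCap (n : ℕ) (t : ℝ) : ℝ :=
  if 0 ≤ t then
    (∫ τ in (0:ℝ)..Real.pi, Real.sin τ ^ (n - 2))⁻¹ * ∫ τ in (0:ℝ)..Real.arccos t, Real.sin τ ^ (n - 2)
  else
    1 - (∫ τ in (0:ℝ)..Real.pi, Real.sin τ ^ (n - 2))⁻¹ * ∫ τ in (0:ℝ)..Real.arccos (-t), Real.sin τ ^ (n - 2)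

noncomputable def locDisc {n N : ℕ} (x : Fin N → (Fin n → ℝ)) (w : Fin n → ℝ) (t : ℝ) : ℝ :=
  |muEmp x w t - muCap n t|

noncomputable def capDisc {n N : ℕ} (x : Fin N → (Fin n → ℝ)) : ℝ :=
  sSup {d : ℝ | ∃ w t, (∑ j, w j ^ 2 = 1) ∧ t ∈ Set.Icc (-1:ℝ) 1 ∧ d = locDisc x w t}

open Matrix

noncomputable def XI {n N : ℕ} (x : Fin N → (Fin n → ℝ)) (I : Finset (Fin N)) :
    Matrix (Fin n) {i // i ∈ I} ℝ :=
  Matrix.of fun j i => x i.1 j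

noncomputable def XtI {n N : ℕ} (x : Fin N → (Fin n → ℝ)) (I : Finset (Fin N)) :
    Matrix (Fin (n+1)) {i // i ∈ I} ℝ :=
  Matrix.of fun j i => (Fin.snoc (x i.1) (-1 : ℝ) : Fin (n+1) → ℝ) j

noncomputable def gammaI {n N : ℕ} (x : Fin N → (Fin n → ℝ)) (I : Finset (Fin N)) : ℝ :=
  ∑ i, (((XtI x I)ᵀ * XtI x I)⁻¹ *ᵥ fun _ => (1:ℝ)) i

noncomputable def tI {n N : ℕ} (x : Fin N → (Fin n → ℝ)) (I : Finset (Fin N)) : ℝ :=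
  Real.sqrt ((1 - gammaI x I) / gammaI x I)

noncomputable def wI {n N : ℕ} (x : Fin N → (Fin n → ℝ)) (I : Finset (Fin N)) : Fin n → ℝ :=
  ((1 + tI x I ^ 2) / tI x I) • ((XI x I) *ᵥ (((XtI x I)ᵀ * XtI x I)⁻¹ *ᵥ fun _ => (1:ℝ)))

noncomputable def Phi1 {n N : ℕ} (x : Fin N → (Fin n → ℝ)) : Set (Finset (Fin N)) :=
  {I | 1 ≤ (XtI x I).rank ∧ (XtI x I).rank = I.card ∧
    I.card ≤ min n ((XtI x Finset.univ).rank) ∧ gammaI x I < 1}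

noncomputable def Phi0 {n N : ℕ} (x : Fin N → (Fin n → ℝ)) : Set (Finset (Fin N)) :=
  {I | 1 ≤ (XtI x I).rank ∧ (XtI x I).rank = I.card ∧
    I.card = min n ((XtI x Finset.univ).rank) ∧ gammaI x I = 1}

noncomputable def Delta1 {n N : ℕ} (x : Fin N → (Fin n → ℝ)) : ℝ :=
  sSup {d : ℝ | ∃ I ∈ Phi1 x,
    d = max (locDisc x (wI x I) (tI x I)) (locDisc x (-(wI x I)) (-(tI x I)))}

noncomputable def Delta0 {n N : ℕ} (x : Fin N → (Fin n → ℝ))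
    (w0 : Finset (Fin N) → (Fin n → ℝ)) : ℝ :=
  sSup {d : ℝ | ∃ I ∈ Phi0 x,
    d = max (locDisc x (w0 I) 0) (locDisc x (-(w0 I)) 0)}

lemma cap_const_pos (m : ℕ) : 0 < ∫ τ in (0:ℝ)..Real.pi, Real.sin τ ^ m := integral_sin_pow_pos m

lemma sin_pow_ii (m : ℕ) (a b : ℝ) :
    IntervalIntegrable (fun τ => Real.sin τ ^ m) MeasureTheory.volume a b :=
  (by fun_prop : Continuous fun τ => Real.sin τ ^ m).intervalIntegrable a b

lemma cap_flip (n : ℕ) (t : ℝ) :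
    1 - (∫ τ in (0:ℝ)..Real.pi, Real.sin τ ^ (n - 2))⁻¹ *
      ∫ τ in (0:ℝ)..Real.arccos (-t), Real.sin τ ^ (n - 2)
    = (∫ τ in (0:ℝ)..Real.pi, Real.sin τ ^ (n - 2))⁻¹ *
      ∫ τ in (0:ℝ)..Real.arccos t, Real.sin τ ^ (n - 2) := by
  have hC := cap_const_pos (n-2)
  have h1 : ∫ τ in (0:ℝ)..Real.arccos (-t), Real.sin τ ^ (n - 2)
      = ∫ τ in (Real.arccos t)..Real.pi, Real.sin τ ^ (n - 2) := by
    have := intervalIntegral.integral_comp_sub_left (a := 0) (b := Real.arccos (-t))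
      (fun τ => Real.sin τ ^ (n - 2)) Real.pi
    simp only [Real.sin_pi_sub, sub_zero] at this
    rw [this, Real.arccos_neg]; congr 1; ring
  have h2 := intervalIntegral.integral_add_adjacent_intervals
    (sin_pow_ii (n-2) 0 (Real.arccos t)) (sin_pow_ii (n-2) (Real.arccos t) Real.pi)
  rw [h1]
  field_simp
  linarith

lemma muCap_eq (n : ℕ) (t : ℝ) : muCap n t = (∫ τ in (0:ℝ)..Real.pi, Real.sin τ ^ (n - 2))⁻¹ *
      ∫ τ in (0:ℝ)..Real.arccos t, Real.sin τ ^ (n - 2) := by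
  unfold muCap
  split_ifs
  · rfl
  · exact cap_flip n t

lemma muCap_neg (n : ℕ) (t : ℝ) : muCap n (-t) = 1 - muCap n t := by
  rw [muCap_eq, muCap_eq, ← cap_flip n t]; ring

lemma muCap_cont (n : ℕ) : Continuous (muCap n) := by
  have : muCap n = fun t => (∫ τ in (0:ℝ)..Real.pi, Real.sin τ ^ (n - 2))⁻¹ *
      ∫ τ in (0:ℝ)..Real.arccos t, Real.sin τ ^ (n - 2) := funext (muCap_eq n)
  rw [this]
  refine continuous_const.mul ?_
  exact (intervalIntegral.continuous_primitive (sin_pow_ii (n-2)) 0).comp Real.continuous_arccos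

lemma muCap_strict (n : ℕ) {s t : ℝ} (hs : -1 ≤ s) (hst : s < t) (ht : t ≤ 1) :
    muCap n t < muCap n s := by
  rw [muCap_eq, muCap_eq]
  have hC := cap_const_pos (n-2)
  have hlt : Real.arccos t < Real.arccos s :=
    Real.strictAntiOn_arccos ⟨hs, by linarith⟩ ⟨by linarith, ht⟩ hst
  have h2 := intervalIntegral.integral_add_adjacent_intervals
    (sin_pow_ii (n-2) 0 (Real.arccos t)) (sin_pow_ii (n-2) (Real.arccos t) (Real.arccos s))
  have h3 : 0 < ∫ τ in (Real.arccos t)..(Real.arccos s), Real.sin τ ^ (n - 2) := by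
    refine intervalIntegral.intervalIntegral_pos_of_pos_on (sin_pow_ii _ _ _) ?_ hlt
    intro y hy
    exact pow_pos (Real.sin_pos_of_pos_of_lt_pi
      (lt_of_le_of_lt (Real.arccos_nonneg t) hy.1) (lt_of_lt_of_le hy.2 (Real.arccos_le_pi s))) _
  rw [← h2]
  exact mul_lt_mul_of_pos_left (by linarith) (inv_pos.mpr hC)

lemma muCap_one (n : ℕ) : muCap n 1 = 0 := by
  rw [muCap_eq]; simp

lemma muCap_nonneg (n : ℕ) (t : ℝ) : 0 ≤ muCap n t := by
  rw [muCap_eq]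
  refine mul_nonneg (inv_nonneg.mpr (cap_const_pos _).le) ?_
  refine intervalIntegral.integral_nonneg (Real.arccos_nonneg t) ?_
  intro u hu
  exact pow_nonneg (Real.sin_nonneg_of_nonneg_of_le_pi hu.1 (hu.2.trans (Real.arccos_le_pi t))) _

lemma muCap_le_one (n : ℕ) (t : ℝ) : muCap n t ≤ 1 := by
  have := muCap_nonneg n (-t)
  rw [muCap_neg] at this; linarith

lemma dot_sq_le {n : ℕ} (u v : Fin n → ℝ) : (u ⬝ᵥ v)^2 ≤ (u ⬝ᵥ u) * (v ⬝ᵥ v) := by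
  have := Finset.sum_mul_sq_le_sq_mul_sq Finset.univ u v
  simpa [dotProduct, sq] using this

lemma dot_self_nonneg {n : ℕ} (u : Fin n → ℝ) : 0 ≤ u ⬝ᵥ u :=
  Finset.sum_nonneg fun i _ => mul_self_nonneg _

noncomputable def capS {n N : ℕ} (x : Fin N → (Fin n → ℝ)) (w : Fin n → ℝ) (t : ℝ) :
    Finset (Fin N) := Finset.univ.filter fun i => t ≤ w ⬝ᵥ x i

noncomputable def FF {n N : ℕ} (x : Fin N → (Fin n → ℝ)) (w : Fin n → ℝ) (t : ℝ) : ℝ :=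
  muEmp x w t - muCap n t

lemma muEmp_eq {n N : ℕ} (x : Fin N → (Fin n → ℝ)) (w : Fin n → ℝ) (t : ℝ) :
    muEmp x w t = (capS x w t).card / N := rfl

lemma mem_capS {n N : ℕ} {x : Fin N → (Fin n → ℝ)} {w : Fin n → ℝ} {t : ℝ} {i : Fin N} :
    i ∈ capS x w t ↔ t ≤ w ⬝ᵥ x i := by simp [capS]

def IsMx {n N : ℕ} (x : Fin N → (Fin n → ℝ)) (w : Fin n → ℝ) (t : ℝ) : Prop :=
  w ⬝ᵥ w = 1 ∧ t ∈ Set.Icc (-1:ℝ) 1 ∧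
    ∀ w' t', w' ⬝ᵥ w' = 1 → t' ∈ Set.Icc (-1:ℝ) 1 → FF x w' t' ≤ FF x w t

lemma muEmp_nonneg {n N : ℕ} (x : Fin N → (Fin n → ℝ)) (w : Fin n → ℝ) (t : ℝ) :
    0 ≤ muEmp x w t := by rw [muEmp_eq]; positivity

lemma muEmp_le_one {n N : ℕ} (hN : 0 < N) (x : Fin N → (Fin n → ℝ)) (w : Fin n → ℝ) (t : ℝ) :
    muEmp x w t ≤ 1 := by
  rw [muEmp_eq, div_le_one (by exact_mod_cast hN)]
  have := Finset.card_le_univ (capS x w t)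
  simp at this
  exact_mod_cast this

lemma locDisc_le_one {n N : ℕ} (hN : 0 < N) (x : Fin N → (Fin n → ℝ)) (w : Fin n → ℝ) (t : ℝ) :
    locDisc x w t ≤ 1 := by
  unfold locDisc
  have h1 := muEmp_nonneg x w t
  have h2 := muEmp_le_one hN x w t
  have h3 := muCap_nonneg n t
  have h4 := muCap_le_one n t
  rw [abs_le]; constructor <;> linarith

lemma unit_dot_mem {n : ℕ} {u v : Fin n → ℝ} (hu : u ⬝ᵥ u = 1) (hv : v ⬝ᵥ v = 1) :
    u ⬝ᵥ v ∈ Set.Icc (-1:ℝ) 1 := by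
  have := dot_sq_le u v
  rw [hu, hv] at this
  constructor <;> nlinarith

lemma FF_le_locDisc {n N : ℕ} (x : Fin N → (Fin n → ℝ)) (w : Fin n → ℝ) (t : ℝ) :
    FF x w t ≤ locDisc x w t := le_abs_self _

lemma card_flip {n N : ℕ} (x : Fin N → (Fin n → ℝ)) (w : Fin n → ℝ) (t : ℝ) :
    (N:ℝ) ≤ (capS x w t).card + (capS x (-w) (-t)).card := by
  have h : (Finset.univ : Finset (Fin N)) ⊆ capS x w t ∪ capS x (-w) (-t) := by
    intro i _
    rw [Finset.mem_union, mem_capS, mem_capS, neg_dotProduct]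
    rcases le_total t (w ⬝ᵥ x i) with h | h
    · exact Or.inl h
    · right; linarith
  have h1 := (Finset.card_le_card h).trans (Finset.card_union_le _ _)
  simp at h1
  exact_mod_cast h1

lemma locDisc_le_of_max {n N : ℕ} (hN : 0 < N) (x : Fin N → (Fin n → ℝ)) {w : Fin n → ℝ} {t : ℝ}
    (h : IsMx x w t) {w' : Fin n → ℝ} {t' : ℝ} (hw' : w' ⬝ᵥ w' = 1) (ht' : t' ∈ Set.Icc (-1:ℝ) 1) :
    locDisc x w' t' ≤ FF x w t := by
  unfold locDisc
  rw [abs_le']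
  refine ⟨h.2.2 w' t' hw' ht', ?_⟩
  have h2 := h.2.2 (-w') (-t') (by simpa using hw') ⟨by linarith [ht'.2], by linarith [ht'.1]⟩
  refine le_trans ?_ h2
  unfold FF
  rw [muCap_neg, muEmp_eq, muEmp_eq]
  have h3 := card_flip x w' t'
  have hN' : (0:ℝ) < N := by exact_mod_cast hN
  have : (1:ℝ) ≤ (capS x w' t').card / N + (capS x (-w') (-t')).card / N := by
    rw [← add_div, le_div_iff₀ hN']; linarith
  linarith

lemma exists_max {n N : ℕ} (hN : 0 < N) (x : Fin N → (Fin n → ℝ)) (hx : ∀ i, x i ⬝ᵥ x i = 1) :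
    ∃ w t, IsMx x w t := by
  let K : Set ((Fin n → ℝ) × ℝ) := {w | w ⬝ᵥ w = 1} ×ˢ Set.Icc (-1:ℝ) 1
  have hK : IsCompact K := by
    refine IsCompact.prod ?_ isCompact_Icc
    refine IsCompact.of_isClosed_subset (isCompact_univ_pi (fun _ : Fin n => isCompact_Icc (a := (-1:ℝ)) (b := 1))) ?_ ?_
    · exact isClosed_eq (by unfold dotProduct; fun_prop) continuous_const
    · intro w hw j _
      have : w j * w j ≤ w ⬝ᵥ w :=
        Finset.single_le_sum (f := fun j => w j * w j) (fun _ _ => mul_self_nonneg _) (Finset.mem_univ j)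
      rw [hw] at this
      constructor <;> nlinarith
  have hne : K.Nonempty := ⟨(x ⟨0, hN⟩, 1), hx _, by norm_num⟩
  have husc : UpperSemicontinuous (fun p : (Fin n → ℝ) × ℝ => FF x p.1 p.2) := by
    have h1 : UpperSemicontinuous (fun p : (Fin n → ℝ) × ℝ => ∑ i : Fin N,
        Set.indicator {p : (Fin n → ℝ) × ℝ | p.2 ≤ p.1 ⬝ᵥ x i} (fun _ => (1:ℝ)/N) p) := by
      refine upperSemicontinuous_sum fun i _ => ?_
      refine IsClosed.upperSemicontinuous_indicator (y := (1:ℝ)/N) ?_ (by positivity)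
      exact isClosed_le continuous_snd (by unfold dotProduct; fun_prop)
    have h2 : UpperSemicontinuous (fun p : (Fin n → ℝ) × ℝ => - muCap n p.2) :=
      ((muCap_cont n).comp continuous_snd).neg.upperSemicontinuous
    have h3 := h1.add h2
    have heq : (fun p : (Fin n → ℝ) × ℝ => FF x p.1 p.2) = fun p : (Fin n → ℝ) × ℝ => (∑ i : Fin N,
        Set.indicator {p : (Fin n → ℝ) × ℝ | p.2 ≤ p.1 ⬝ᵥ x i} (fun _ => (1:ℝ)/N) p)
          + - muCap n p.2 := ?_
    · rw [heq]; exact h3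
    funext p
    simp only [FF]
    rw [muEmp_eq, sub_eq_add_neg]
    congr 1
    simp [Set.indicator_apply, Finset.sum_ite, capS, div_eq_mul_inv]
  obtain ⟨p, hp, hmax⟩ := (husc.upperSemicontinuousOn K).exists_isMaxOn hne hK
  exact ⟨p.1, p.2, hp.1, hp.2, fun w' t' h1 h2 => hmax (a := (w', t')) ⟨h1, h2⟩⟩

lemma max_pos {n N : ℕ} (hN : 0 < N) (x : Fin N → (Fin n → ℝ)) (hx : ∀ i, x i ⬝ᵥ x i = 1)
    {w : Fin n → ℝ} {t : ℝ} (h : IsMx x w t) : 0 < FF x w t := by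
  refine lt_of_lt_of_le ?_ (h.2.2 (x ⟨0, hN⟩) 1 (hx _) (by norm_num))
  unfold FF
  rw [muCap_one, muEmp_eq, sub_zero]
  have : 0 < (capS x (x ⟨0, hN⟩) 1).card := Finset.card_pos.mpr ⟨⟨0, hN⟩, mem_capS.mpr (hx _).ge⟩
  positivity

lemma cap_nonempty {n N : ℕ} (hN : 0 < N) (x : Fin N → (Fin n → ℝ)) (hx : ∀ i, x i ⬝ᵥ x i = 1)
    {w : Fin n → ℝ} {t : ℝ} (h : IsMx x w t) : (capS x w t).Nonempty := by
  by_contra hne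
  rw [Finset.not_nonempty_iff_eq_empty] at hne
  have := max_pos hN x hx h
  unfold FF at this
  rw [muEmp_eq, hne] at this
  simp at this
  linarith [muCap_nonneg n t]

lemma FF_mono {n N : ℕ} (x : Fin N → (Fin n → ℝ)) {w w' : Fin n → ℝ} {t : ℝ}
    (h : capS x w t ⊆ capS x w' t) : FF x w t ≤ FF x w' t := by
  unfold FF
  rw [muEmp_eq, muEmp_eq]
  have : ((capS x w t).card : ℝ) ≤ (capS x w' t).card := by exact_mod_cast Finset.card_le_card h
  gcongr

/-- no strict improvement of the height is possible at a maximizer -/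
lemma max_imp {n N : ℕ} (hN : 0 < N) (x : Fin N → (Fin n → ℝ)) (hx : ∀ i, x i ⬝ᵥ x i = 1)
    {w : Fin n → ℝ} {t : ℝ} (h : IsMx x w t) (u : Fin n → ℝ) (s : ℝ)
    (hu : ∀ i ∈ capS x w t, s ≤ u ⬝ᵥ x i) : s ≤ t * Real.sqrt (u ⬝ᵥ u) := by
  obtain ⟨i0, hi0⟩ := cap_nonempty hN x hx h
  rcases (dot_self_nonneg u).eq_or_lt with h0 | hpos
  · rw [← h0]
    have := hu i0 hi0
    have h2 := dot_sq_le u (x i0)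
    rw [← h0, zero_mul] at h2
    have : u ⬝ᵥ x i0 = 0 := by nlinarith [sq_nonneg (u ⬝ᵥ x i0)]
    simp; linarith
  · set r := Real.sqrt (u ⬝ᵥ u) with hr
    have hrp : 0 < r := Real.sqrt_pos.mpr hpos
    have hrr : r * r = u ⬝ᵥ u := Real.mul_self_sqrt hpos.le
    by_contra hcon
    push Not at hcon
    have hlt : t < s / r := by rwa [lt_div_iff₀ hrp]
    have hunit : (r⁻¹ • u) ⬝ᵥ (r⁻¹ • u) = 1 := by
      rw [smul_dotProduct, dotProduct_smul, ← hrr]; simp only [smul_eq_mul]; field_simp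
    have hall : ∀ i ∈ capS x w t, s / r ≤ (r⁻¹ • u) ⬝ᵥ x i := by
      intro i hi
      rw [smul_dotProduct, smul_eq_mul, div_eq_inv_mul]
      exact mul_le_mul_of_nonneg_left (hu i hi) (inv_pos.mpr hrp).le
    have hle : s / r ≤ 1 := (hall i0 hi0).trans (unit_dot_mem hunit (hx i0)).2
    have h1 := h.2.2 (r⁻¹ • u) (s / r) hunit ⟨by linarith [h.2.1.1], hle⟩
    have h2 := muCap_strict n h.2.1.1 hlt hle
    have h3 : ((capS x w t).card : ℝ) ≤ (capS x (r⁻¹ • u) (s/r)).card := by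
      exact_mod_cast Finset.card_le_card fun i hi => mem_capS.mpr (hall i hi)
    have h4 : ((capS x w t).card : ℝ) / N ≤ (capS x (r⁻¹ • u) (s/r)).card / N := by gcongr
    unfold FF at h1
    rw [muEmp_eq, muEmp_eq] at h1
    linarith

def xt {n N : ℕ} (x : Fin N → (Fin n → ℝ)) (i : Fin N) : Fin (n+1) → ℝ :=
  (Fin.snoc (x i) (-1 : ℝ) : Fin (n+1) → ℝ)

lemma snoc_dot {n : ℕ} (v v' : Fin n → ℝ) (s s' : ℝ) :
    (Fin.snoc v s : Fin (n+1) → ℝ) ⬝ᵥ (Fin.snoc v' s' : Fin (n+1) → ℝ) = v ⬝ᵥ v' + s * s' := by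
  simp [dotProduct, Fin.sum_univ_castSucc]

lemma snoc_dot_xt {n N : ℕ} (x : Fin N → (Fin n → ℝ)) (i : Fin N) (v : Fin n → ℝ) (s : ℝ) :
    (Fin.snoc v s : Fin (n+1) → ℝ) ⬝ᵥ xt x i = v ⬝ᵥ x i - s := by
  unfold xt; rw [snoc_dot]; ring

lemma rank_XtI {n N : ℕ} (x : Fin N → (Fin n → ℝ)) (I : Finset (Fin N)) :
    (XtI x I).rank = Module.finrank ℝ (Submodule.span ℝ (xt x '' (I : Set (Fin N)))) := by
  rw [Matrix.rank_eq_finrank_span_cols]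
  have : Set.range (XtI x I).col = xt x '' (I : Set (Fin N)) := ?_
  · rw [this]
  ext u
  simp only [Set.mem_range, Set.mem_image]
  constructor
  · rintro ⟨i, rfl⟩; exact ⟨i.1, i.2, rfl⟩
  · rintro ⟨i, hi, rfl⟩; exact ⟨⟨i, hi⟩, rfl⟩

lemma rank_le_univ {n N : ℕ} (x : Fin N → (Fin n → ℝ)) (I : Finset (Fin N)) :
    (XtI x I).rank ≤ (XtI x Finset.univ).rank := by
  rw [rank_XtI, rank_XtI]
  exact Submodule.finrank_mono (Submodule.span_mono (Set.image_mono (by simp)))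

lemma rank_eq_card_iff {n N : ℕ} (x : Fin N → (Fin n → ℝ)) (I : Finset (Fin N)) :
    (XtI x I).rank = I.card ↔ LinearIndependent ℝ (fun i : {i // i ∈ I} => xt x i.1) := by
  rw [linearIndependent_iff_card_eq_finrank_span, Matrix.rank_eq_finrank_span_cols,
    Fintype.card_coe, eq_comm]
  rfl

lemma rank_add_ker {n N : ℕ} (x : Fin N → (Fin n → ℝ)) (I : Finset (Fin N)) :
    (XtI x I).rank + Module.finrank ℝ (LinearMap.ker (XtI x I)ᵀ.mulVecLin) = n + 1 := by
  rw [← Matrix.rank_transpose]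
  have := LinearMap.finrank_range_add_finrank_ker (XtI x I)ᵀ.mulVecLin
  rw [Module.finrank_fin_fun] at this
  exact this

lemma mem_ker_iff {n N : ℕ} (x : Fin N → (Fin n → ℝ)) (I : Finset (Fin N)) (u : Fin (n+1) → ℝ) :
    u ∈ LinearMap.ker (XtI x I)ᵀ.mulVecLin ↔ ∀ i ∈ I, u ⬝ᵥ xt x i = 0 := by
  rw [LinearMap.mem_ker, Matrix.mulVecLin_apply, funext_iff]
  constructor
  · intro h i hi
    rw [dotProduct_comm]; exact h ⟨i, hi⟩
  · intro h i
    have := h i.1 i.2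
    rw [dotProduct_comm] at this; exact this

lemma rank_le_n {n N : ℕ} (x : Fin N → (Fin n → ℝ)) (I : Finset (Fin N)) {u : Fin (n+1) → ℝ}
    (hu : u ≠ 0) (h : ∀ i ∈ I, u ⬝ᵥ xt x i = 0) : (XtI x I).rank ≤ n := by
  have h1 := rank_add_ker x I
  have h2 : 0 < Module.finrank ℝ (LinearMap.ker (XtI x I)ᵀ.mulVecLin) := by
    rw [Module.finrank_pos_iff_exists_ne_zero]
    exact ⟨⟨u, (mem_ker_iff x I u).mpr h⟩, fun h => hu (congrArg Subtype.val h)⟩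
  omega

lemma n_le_rank {n N : ℕ} (x : Fin N → (Fin n → ℝ)) (I : Finset (Fin N)) (u : Fin (n+1) → ℝ)
    (h : ∀ v : Fin (n+1) → ℝ, (∀ i ∈ I, v ⬝ᵥ xt x i = 0) → ∃ a : ℝ, v = a • u) :
    n ≤ (XtI x I).rank := by
  have h1 := rank_add_ker x I
  have h2 : Module.finrank ℝ (LinearMap.ker (XtI x I)ᵀ.mulVecLin) ≤ 1 := by
    have hle : LinearMap.ker (XtI x I)ᵀ.mulVecLin ≤ Submodule.span ℝ {u} := by
      intro v hv
      obtain ⟨a, rfl⟩ := h v ((mem_ker_iff x I v).mp hv)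
      exact Submodule.mem_span_singleton.mpr ⟨a, rfl⟩
    exact (Submodule.finrank_mono hle).trans (finrank_span_le_card _ |>.trans (by simp))
  omega

noncomputable def cI {n N : ℕ} (x : Fin N → (Fin n → ℝ)) (I : Finset (Fin N)) : {i // i ∈ I} → ℝ :=
  ((XtI x I)ᵀ * XtI x I)⁻¹ *ᵥ fun _ => (1:ℝ)

noncomputable def yI {n N : ℕ} (x : Fin N → (Fin n → ℝ)) (I : Finset (Fin N)) : Fin n → ℝ :=
  XI x I *ᵥ cI x I

lemma gammaI_eq {n N : ℕ} (x : Fin N → (Fin n → ℝ)) (I : Finset (Fin N)) :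
    gammaI x I = ∑ i, cI x I i := rfl

lemma dot_yI {n N : ℕ} (x : Fin N → (Fin n → ℝ)) (I : Finset (Fin N)) (u : Fin n → ℝ) :
    u ⬝ᵥ yI x I = ∑ i, cI x I i * (u ⬝ᵥ x i.1) := by
  unfold yI
  rw [Matrix.dotProduct_mulVec]
  refine Finset.sum_congr rfl fun i _ => ?_
  rw [mul_comm]; rfl

lemma gram_unit {n N : ℕ} (x : Fin N → (Fin n → ℝ)) (I : Finset (Fin N))
    (hli : LinearIndependent ℝ (fun i : {i // i ∈ I} => xt x i.1)) :
    IsUnit ((XtI x I)ᵀ * XtI x I) := by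
  rw [← Matrix.mulVec_injective_iff_isUnit]
  have h1 : Function.Injective (XtI x I).mulVec := by
    rw [Matrix.mulVec_injective_iff]; exact hli
  have h2 : Function.Injective ((XtI x I)ᵀ * XtI x I).mulVecLin := by
    rw [← LinearMap.ker_eq_bot, Matrix.ker_mulVecLin_transpose_mul_self, LinearMap.ker_eq_bot]
    exact h1
  exact h2

lemma yI_dot {n N : ℕ} (x : Fin N → (Fin n → ℝ)) (I : Finset (Fin N))
    (hli : LinearIndependent ℝ (fun i : {i // i ∈ I} => xt x i.1)) (i : Fin N) (hi : i ∈ I) :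
    yI x I ⬝ᵥ x i = 1 - gammaI x I := by
  have hG : ((XtI x I)ᵀ * XtI x I) *ᵥ cI x I = fun _ => 1 := by
    unfold cI
    rw [Matrix.mulVec_mulVec, Matrix.mul_nonsing_inv _ ((Matrix.isUnit_iff_isUnit_det _).mp (gram_unit x I hli)),
      Matrix.one_mulVec]
  have h1 := congrFun hG ⟨i, hi⟩
  have h2 : (((XtI x I)ᵀ * XtI x I) *ᵥ cI x I) ⟨i, hi⟩ = ∑ k, (x i ⬝ᵥ x k.1 + 1) * cI x I k := by
    refine Finset.sum_congr rfl fun k _ => ?_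
    congr 1
    have := snoc_dot (x i) (x k.1) (-1) (-1)
    norm_num at this
    exact this
  rw [h2] at h1
  rw [dotProduct_comm, dot_yI, gammaI_eq]
  simp only [add_mul, Finset.sum_add_distrib, one_mul] at h1
  simp only [mul_comm (cI x I _)]
  linarith

lemma yI_sq {n N : ℕ} (x : Fin N → (Fin n → ℝ)) (I : Finset (Fin N))
    (hli : LinearIndependent ℝ (fun i : {i // i ∈ I} => xt x i.1)) :
    yI x I ⬝ᵥ yI x I = gammaI x I * (1 - gammaI x I) := by
  rw [dot_yI, gammaI_eq, Finset.sum_mul]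
  refine Finset.sum_congr rfl fun i _ => ?_
  rw [yI_dot x I hli i.1 i.2, gammaI_eq]

lemma gamma_bounds {n N : ℕ} (x : Fin N → (Fin n → ℝ)) (I : Finset (Fin N))
    (hli : LinearIndependent ℝ (fun i : {i // i ∈ I} => xt x i.1)) (hne : I.Nonempty) :
    0 < gammaI x I ∧ gammaI x I ≤ 1 := by
  have h1 := yI_sq x I hli
  have h2 := dot_self_nonneg (yI x I)
  have h3 : gammaI x I ≠ 0 := by
    intro h0
    obtain ⟨i, hi⟩ := hne
    rw [h0, zero_mul] at h1
    have h4 := yI_dot x I hli i hi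
    rw [dotProduct_self_eq_zero.mp h1, h0] at h4
    simp at h4
  have h5 : 0 ≤ gammaI x I := by nlinarith [sq_nonneg (gammaI x I)]
  have h6 : 0 < gammaI x I := lt_of_le_of_ne h5 (Ne.symm h3)
  refine ⟨h6, ?_⟩
  by_contra h
  push Not at h
  nlinarith

lemma wI_eq {n N : ℕ} (x : Fin N → (Fin n → ℝ)) (I : Finset (Fin N)) :
    wI x I = ((1 + tI x I ^ 2) / tI x I) • yI x I := rfl

lemma tI_sq {n N : ℕ} (x : Fin N → (Fin n → ℝ)) (I : Finset (Fin N))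
    (hli : LinearIndependent ℝ (fun i : {i // i ∈ I} => xt x i.1)) (hne : I.Nonempty)
    (hg : gammaI x I < 1) : 0 < tI x I ∧ tI x I ^ 2 * gammaI x I = 1 - gammaI x I := by
  obtain ⟨h0, h1⟩ := gamma_bounds x I hli hne
  have hp : 0 < (1 - gammaI x I) / gammaI x I := div_pos (by linarith) h0
  refine ⟨Real.sqrt_pos.mpr hp, ?_⟩
  unfold tI
  rw [Real.sq_sqrt hp.le]; field_simp

lemma wI_unit {n N : ℕ} (x : Fin N → (Fin n → ℝ)) (hx : ∀ i, x i ⬝ᵥ x i = 1) (I : Finset (Fin N))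
    (hli : LinearIndependent ℝ (fun i : {i // i ∈ I} => xt x i.1)) (hne : I.Nonempty)
    (hg : gammaI x I < 1) : wI x I ⬝ᵥ wI x I = 1 ∧ tI x I ∈ Set.Icc (-1:ℝ) 1 := by
  obtain ⟨h0, h1⟩ := gamma_bounds x I hli hne
  obtain ⟨ht, ht2⟩ := tI_sq x I hli hne hg
  have hs : (1 + tI x I ^ 2) * gammaI x I = 1 := by linarith
  have hu : wI x I ⬝ᵥ wI x I = 1 := by
    rw [wI_eq, smul_dotProduct, dotProduct_smul, yI_sq x I hli, ← ht2]
    simp only [smul_eq_mul]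
    field_simp
    nlinarith
  refine ⟨hu, ?_⟩
  obtain ⟨i, hi⟩ := hne
  have : wI x I ⬝ᵥ x i = tI x I := by
    rw [wI_eq, smul_dotProduct, yI_dot x I hli i hi, ← ht2, smul_eq_mul]
    field_simp
    linarith
  rw [← this]
  exact unit_dot_mem hu (hx i)

lemma span_self_dot {n : ℕ} {S : Set (Fin n → ℝ)} {d u : Fin n → ℝ} (hd : u ∈ Submodule.span ℝ S)
    (h : ∀ v ∈ S, d ⬝ᵥ v = 0) : d ⬝ᵥ u = 0 := by
  induction hd using Submodule.span_induction with
  | mem v hv => exact h v hv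
  | zero => simp
  | add a b _ _ ha hb => rw [dotProduct_add, ha, hb, add_zero]
  | smul a v _ hv => rw [dotProduct_smul, hv, smul_zero]

lemma yI_mem {n N : ℕ} (x : Fin N → (Fin n → ℝ)) (I : Finset (Fin N)) :
    yI x I ∈ Submodule.span ℝ (x '' (I : Set (Fin N))) := by
  have : yI x I = ∑ i, cI x I i • x i.1 := by
    unfold yI
    ext j
    simp [Matrix.mulVec, dotProduct, XI, Finset.sum_apply, mul_comm]
  rw [this]
  exact Submodule.sum_mem _ fun i _ => Submodule.smul_mem _ _
    (Submodule.subset_span ⟨i.1, i.2, rfl⟩)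

lemma wI_unique {n N : ℕ} (x : Fin N → (Fin n → ℝ)) (I : Finset (Fin N))
    (hli : LinearIndependent ℝ (fun i : {i // i ∈ I} => xt x i.1)) (hne : I.Nonempty)
    {w : Fin n → ℝ} {t : ℝ} (ht : 0 < t) (hw : w ⬝ᵥ w = 1)
    (hwI : ∀ i ∈ I, w ⬝ᵥ x i = t) (hspan : w ∈ Submodule.span ℝ (x '' (I : Set (Fin N)))) :
    gammaI x I < 1 ∧ wI x I = w ∧ tI x I = t := by
  obtain ⟨h0, h1⟩ := gamma_bounds x I hli hne
  have hwy : w ⬝ᵥ yI x I = t * gammaI x I := by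
    rw [dot_yI, gammaI_eq, Finset.mul_sum]
    refine Finset.sum_congr rfl fun i _ => ?_
    rw [hwI i.1 i.2, mul_comm]
  have hg : gammaI x I < 1 := by
    refine lt_of_le_of_ne h1 fun h => ?_
    have h2 := yI_sq x I hli
    rw [h, sub_self, mul_zero] at h2
    rw [dotProduct_self_eq_zero.mp h2, h, dotProduct_zero] at hwy
    linarith
  have hd : (1 - gammaI x I) • w - t • yI x I = 0 := by
    rw [← dotProduct_self_eq_zero]
    refine span_self_dot (S := x '' (I : Set (Fin N))) ?_ ?_
    · exact Submodule.sub_mem _ (Submodule.smul_mem _ _ hspan) (Submodule.smul_mem _ _ (yI_mem x I))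
    · rintro _ ⟨i, hi, rfl⟩
      rw [sub_dotProduct, smul_dotProduct, smul_dotProduct, hwI i hi, yI_dot x I hli i hi]
      simp only [smul_eq_mul]; ring
  have he : (1 - gammaI x I) • w = t • yI x I := sub_eq_zero.mp hd
  have hsq : 1 - gammaI x I = t ^ 2 * gammaI x I := by
    have := congrArg (fun v => w ⬝ᵥ v) he
    simp only [dotProduct_smul, hw, hwy, smul_eq_mul] at this
    linarith
  have htI : tI x I = t := by
    unfold tI
    rw [hsq, mul_div_cancel_right₀ _ h0.ne', Real.sqrt_sq ht.le]
  refine ⟨hg, ?_, htI⟩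
  rw [wI_eq, htI]
  have h3 : yI x I = ((1 - gammaI x I) / t) • w := by
    rw [div_eq_inv_mul, mul_smul, he, smul_smul, inv_mul_cancel₀ ht.ne', one_smul]
  rw [h3, smul_smul, hsq]
  have : (1 + t ^ 2) / t * (t ^ 2 * gammaI x I / t) = 1 := by
    field_simp
    linarith
  rw [this, one_smul]

lemma notMem_dot {n : ℕ} {S : Set (Fin n → ℝ)} {w : Fin n → ℝ} (hw : w ∉ Submodule.span ℝ S) :
    ∃ d : Fin n → ℝ, d ⬝ᵥ w ≠ 0 ∧ ∀ v ∈ S, d ⬝ᵥ v = 0 := by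
  obtain ⟨f, hf, hle⟩ := Submodule.exists_le_ker_of_notMem hw
  have key : ∀ v, (fun j => f (Pi.single j 1)) ⬝ᵥ v = f v := by
    intro v
    conv_rhs => rw [pi_eq_sum_univ' v, map_sum]
    refine Finset.sum_congr rfl fun j _ => ?_
    rw [map_smul, smul_eq_mul, mul_comm]
  refine ⟨fun j => f (Pi.single j 1), by rwa [key], fun v hv => ?_⟩
  rw [key]
  exact hle (Submodule.subset_span hv)

lemma select {n N : ℕ} (x : Fin N → (Fin n → ℝ)) (A : Finset (Fin N)) :
    ∃ I ⊆ A, LinearIndependent ℝ (fun i : {i // i ∈ I} => xt x i.1) ∧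
      xt x '' (A : Set (Fin N)) ⊆ Submodule.span ℝ (xt x '' (I : Set (Fin N))) := by
  obtain ⟨b, hb, -, h1, h2⟩ := exists_linearIndepOn_extension (K := ℝ) (v := xt x)
    (linearIndepOn_empty ℝ (xt x)) (Set.empty_subset (A : Set (Fin N)))
  refine ⟨b.toFinset, ?_, ?_, ?_⟩
  · intro i hi; exact_mod_cast hb (by simpa using hi)
  · have h3 : LinearIndepOn ℝ (xt x) (b.toFinset : Set (Fin N)) := by simpa using h2
    exact h3
  · simpa using h1

lemma sel_dot {n N : ℕ} {x : Fin N → (Fin n → ℝ)} {A I : Finset (Fin N)}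
    (h : xt x '' (A : Set (Fin N)) ⊆ Submodule.span ℝ (xt x '' (I : Set (Fin N))))
    {v : Fin n → ℝ} {s : ℝ} (hv : ∀ i ∈ I, v ⬝ᵥ x i = s) : ∀ i ∈ A, v ⬝ᵥ x i = s := by
  intro i hi
  have := span_self_dot (d := (Fin.snoc v s : Fin (n+1) → ℝ)) (h ⟨i, hi, rfl⟩) (by
    rintro _ ⟨k, hk, rfl⟩
    rw [snoc_dot_xt, hv k hk, sub_self])
  rw [snoc_dot_xt] at this
  linarith

lemma sel_span {n N : ℕ} {x : Fin N → (Fin n → ℝ)} {A I : Finset (Fin N)}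
    (h : xt x '' (A : Set (Fin N)) ⊆ Submodule.span ℝ (xt x '' (I : Set (Fin N))))
    {w : Fin n → ℝ} (hw : w ∈ Submodule.span ℝ (x '' (A : Set (Fin N)))) :
    w ∈ Submodule.span ℝ (x '' (I : Set (Fin N))) := by
  by_contra hcon
  obtain ⟨d, hd, hd2⟩ := notMem_dot hcon
  apply hd
  refine span_self_dot hw ?_
  rintro _ ⟨i, hi, rfl⟩
  exact sel_dot h (fun k hk => hd2 _ ⟨k, hk, rfl⟩) i hi

noncomputable def actS {n N : ℕ} (x : Fin N → (Fin n → ℝ)) (w : Fin n → ℝ) (t : ℝ) :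
    Finset (Fin N) := Finset.univ.filter fun i => w ⬝ᵥ x i = t

lemma mem_actS {n N : ℕ} {x : Fin N → (Fin n → ℝ)} {w : Fin n → ℝ} {t : ℝ} {i : Fin N} :
    i ∈ actS x w t ↔ w ⬝ᵥ x i = t := by simp [actS]

/-- for small positive ε, the inactive constraints stay strict -/
lemma perturb {n N : ℕ} (x : Fin N → (Fin n → ℝ)) (w d : Fin n → ℝ) (t k : ℝ) :
    ∀ᶠ ε in nhdsWithin (0:ℝ) (Set.Ioi 0), ∀ i, t < w ⬝ᵥ x i →
      t + ε * k ≤ (w + ε • d) ⬝ᵥ x i := by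
  rw [Filter.eventually_all]
  intro i
  by_cases h : t < w ⬝ᵥ x i
  · have hc : ContinuousAt (fun ε : ℝ => (w ⬝ᵥ x i + ε * (d ⬝ᵥ x i)) - (t + ε * k)) 0 := by fun_prop
    have := hc.eventually (lt_mem_nhds (a := (0:ℝ)) (by simpa using h))
    filter_upwards [nhdsWithin_le_nhds this] with ε hε _
    rw [add_dotProduct, smul_dotProduct, smul_eq_mul]
    linarith
  · exact Filter.Eventually.of_forall fun ε h' => absurd h' h

lemma mem_span_act {n N : ℕ} (hN : 0 < N) (x : Fin N → (Fin n → ℝ)) (hx : ∀ i, x i ⬝ᵥ x i = 1)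
    {w : Fin n → ℝ} {t : ℝ} (h : IsMx x w t) (ht : t ≠ 0) :
    w ∈ Submodule.span ℝ (x '' (actS x w t : Set (Fin N))) := by
  by_contra hcon
  obtain ⟨d0, hd0, hd1⟩ := notMem_dot hcon
  obtain ⟨d, hdw, hda⟩ : ∃ d : Fin n → ℝ, d ⬝ᵥ w = -t ∧ ∀ i, w ⬝ᵥ x i = t → d ⬝ᵥ x i = 0 := by
    refine ⟨(-t / (d0 ⬝ᵥ w)) • d0, ?_, fun i hi => ?_⟩
    · rw [smul_dotProduct, smul_eq_mul]; field_simp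
    · rw [smul_dotProduct, hd1 _ ⟨i, mem_actS.mpr hi, rfl⟩, smul_zero]
  have hc : ContinuousAt (fun ε : ℝ => ε * (t * (d ⬝ᵥ d))) 0 := by fun_prop
  have ht0 : (0:ℝ) * (t * (d ⬝ᵥ d)) < t^2 := by rw [zero_mul]; positivity
  have h2 := hc.eventually (gt_mem_nhds ht0)
  obtain ⟨ε, ⟨h3, h4⟩, h5⟩ := (((perturb x w d t 0).and (nhdsWithin_le_nhds h2)).and
    self_mem_nhdsWithin).exists
  have hε : 0 < ε := h5
  have himp := max_imp hN x hx h (w + ε • d) t (by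
    intro i hi
    rcases (mem_capS.mp hi).eq_or_lt with h6 | h6
    · rw [add_dotProduct, smul_dotProduct, hda i h6.symm, ← h6]; simp
    · have := h3 i h6; linarith)
  have hnorm : (w + ε • d) ⬝ᵥ (w + ε • d) = 1 - 2 * ε * t + ε^2 * (d ⬝ᵥ d) := by
    simp only [add_dotProduct, dotProduct_add, smul_dotProduct, dotProduct_smul, h.1, hdw,
      dotProduct_comm w d, smul_eq_mul]
    ring
  set r := Real.sqrt ((w + ε • d) ⬝ᵥ (w + ε • d)) with hr
  have hr0 : 0 ≤ r := Real.sqrt_nonneg _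
  have hrr : r * r = (w + ε • d) ⬝ᵥ (w + ε • d) := Real.mul_self_sqrt (dot_self_nonneg _)
  have h7 : 0 ≤ t * (r - 1) * (r + 1) := mul_nonneg (by linarith) (by linarith)
  have h8 : t * (r - 1) * (r + 1) = ε * (ε * (t * (d ⬝ᵥ d)) - 2 * t^2) := by
    have : t * (r - 1) * (r + 1) = t * (r * r - 1) := by ring
    rw [this, hrr, hnorm]; ring
  have ht2 : 0 < t^2 := by positivity
  have h9 : ε * (ε * (t * (d ⬝ᵥ d)) - 2 * t^2) < 0 :=
    mul_neg_of_pos_of_neg hε (by linarith)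
  linarith

lemma ne_zero_of_unit {n : ℕ} {w : Fin n → ℝ} (hw : w ⬝ᵥ w = 1) : w ≠ 0 := by
  rintro rfl; simp at hw

lemma snoc_ne_zero {n : ℕ} {w : Fin n → ℝ} (hw : w ⬝ᵥ w = 1) (t : ℝ) :
    (Fin.snoc w t : Fin (n+1) → ℝ) ≠ 0 := by
  intro h
  apply ne_zero_of_unit hw
  ext j
  have := congrFun h j.castSucc
  simpa using this

lemma case_ne {n N : ℕ} (hN : 0 < N) (x : Fin N → (Fin n → ℝ)) (hx : ∀ i, x i ⬝ᵥ x i = 1)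
    {w : Fin n → ℝ} {t : ℝ} (h : IsMx x w t) (ht : t ≠ 0) :
    ∃ I ∈ Phi1 x, (wI x I = w ∧ tI x I = t) ∨ (-(wI x I) = w ∧ -(tI x I) = t) := by
  have hspan := mem_span_act hN x hx h ht
  obtain ⟨I, hIA, hli, hsel⟩ := select x (actS x w t)
  have hspanI := sel_span hsel hspan
  have hact : ∀ i ∈ I, w ⬝ᵥ x i = t := fun i hi => mem_actS.mp (hIA hi)
  have hne : I.Nonempty := by
    by_contra hne
    rw [Finset.not_nonempty_iff_eq_empty] at hne
    rw [hne] at hspanI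
    simp at hspanI
    exact ne_zero_of_unit h.1 hspanI
  have hrank := (rank_eq_card_iff x I).mpr hli
  have hn : (XtI x I).rank ≤ n := rank_le_n x I (snoc_ne_zero h.1 t) (by
    intro i hi; rw [snoc_dot_xt, hact i hi, sub_self])
  have hmem : gammaI x I < 1 → I ∈ Phi1 x := fun hg =>
    ⟨by rw [hrank]; exact Finset.card_pos.mpr hne, hrank,
      by rw [← hrank]; exact le_min hn (rank_le_univ x I), hg⟩
  rcases lt_or_gt_of_ne ht with hneg | hpos
  · obtain ⟨hg, h1, h2⟩ := wI_unique x I hli hne (w := -w) (t := -t) (by linarith)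
      (by simpa using h.1) (fun i hi => by rw [neg_dotProduct, hact i hi])
      (Submodule.neg_mem _ hspanI)
    exact ⟨I, hmem hg, Or.inr ⟨by rw [h1, neg_neg], by rw [h2, neg_neg]⟩⟩
  · obtain ⟨hg, h1, h2⟩ := wI_unique x I hli hne hpos h.1 hact hspanI
    exact ⟨I, hmem hg, Or.inl ⟨h1, h2⟩⟩

lemma no_v {n N : ℕ} (hN : 0 < N) (x : Fin N → (Fin n → ℝ)) (hx : ∀ i, x i ⬝ᵥ x i = 1)
    {w : Fin n → ℝ} (h : IsMx x w 0) (v : Fin n → ℝ) (hv : ∀ i ∈ actS x w 0, v ⬝ᵥ x i = 1) :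
    False := by
  obtain ⟨ε, h3, h5⟩ := ((perturb x w v 0 1).and self_mem_nhdsWithin).exists
  have hε : 0 < ε := h5
  have himp := max_imp hN x hx h (w + ε • v) ε (by
    intro i hi
    rcases (mem_capS.mp hi).eq_or_lt with h6 | h6
    · rw [add_dotProduct, smul_dotProduct, hv i (mem_actS.mpr h6.symm), ← h6]; simp
    · have := h3 i h6; linarith)
  linarith

lemma exists_unit_smul {n : ℕ} {d : Fin n → ℝ} (hd : d ≠ 0) :
    ∃ r : ℝ, 0 < r ∧ (r • d) ⬝ᵥ (r • d) = 1 := by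
  have hpos : 0 < d ⬝ᵥ d :=
    lt_of_le_of_ne (dot_self_nonneg d) (fun h => hd (dotProduct_self_eq_zero.mp h.symm))
  refine ⟨(Real.sqrt (d ⬝ᵥ d))⁻¹, inv_pos.mpr (Real.sqrt_pos.mpr hpos), ?_⟩
  have hrr := Real.mul_self_sqrt hpos.le
  have := Real.sqrt_pos.mpr hpos
  rw [smul_dotProduct, dotProduct_smul]
  simp only [smul_eq_mul]
  field_simp
  nlinarith

/-- any nonzero vector whose closed half space contains the cap gives another maximizer -/
lemma max_of_subset {n N : ℕ} {x : Fin N → (Fin n → ℝ)}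
    {w : Fin n → ℝ} (h : IsMx x w 0) {u : Fin n → ℝ} (hu : u ≠ 0)
    (hc : ∀ i ∈ capS x w 0, 0 ≤ u ⬝ᵥ x i) :
    ∃ u', IsMx x u' 0 ∧ actS x u 0 = actS x u' 0 ∧ capS x u 0 = capS x u' 0 := by
  obtain ⟨r, hr, hru⟩ := exists_unit_smul hu
  have hcap : capS x u 0 = capS x (r • u) 0 := by
    ext i; rw [mem_capS, mem_capS, smul_dotProduct, smul_eq_mul, mul_nonneg_iff_of_pos_left hr]
  refine ⟨r • u, ⟨hru, h.2.1, fun w' t' h1 h2 => (h.2.2 w' t' h1 h2).trans (FF_mono x ?_)⟩, ?_, hcap⟩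
  · rw [← hcap]; exact fun i hi => mem_capS.mpr (hc i hi)
  · ext i; rw [mem_actS, mem_actS, smul_dotProduct, smul_eq_mul]; simp [hr.ne']

lemma act_sub_cap {n N : ℕ} (x : Fin N → (Fin n → ℝ)) (w : Fin n → ℝ) (t : ℝ) :
    actS x w t ⊆ capS x w t := fun _ hi => mem_capS.mpr (mem_actS.mp hi).ge

lemma dichotomy_aux {n N : ℕ} (x : Fin N → (Fin n → ℝ))
    {w : Fin n → ℝ} (h : IsMx x w 0)
    (hmax : ∀ w', IsMx x w' 0 → (actS x w' 0).card ≤ (actS x w 0).card)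
    {d : Fin n → ℝ} (hda : ∀ i ∈ actS x w 0, d ⬝ᵥ x i = 0) (hdw : d ⬝ᵥ w = 0) :
    ∀ i ∈ capS x w 0, 0 ≤ d ⬝ᵥ x i := by
  by_contra hcon
  push Not at hcon
  obtain ⟨i1, hi1, hi1'⟩ := hcon
  obtain ⟨i0, hi0, hmin⟩ := Finset.exists_min_image
    ((capS x w 0).filter fun i => d ⬝ᵥ x i < 0) (fun i => (w ⬝ᵥ x i) / (-(d ⬝ᵥ x i)))
    ⟨i1, by simp [hi1, hi1']⟩
  rw [Finset.mem_filter, mem_capS] at hi0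
  set s := (w ⬝ᵥ x i0) / (-(d ⬝ᵥ x i0)) with hs
  have hs0 : 0 ≤ s := div_nonneg hi0.1 (by linarith [hi0.2])
  have hdot : ∀ i, (w + s • d) ⬝ᵥ x i = w ⬝ᵥ x i + s * (d ⬝ᵥ x i) := fun i => by
    rw [add_dotProduct, smul_dotProduct, smul_eq_mul]
  have hu0 : w + s • d ≠ 0 := by
    intro h0
    have h1 : (w + s • d) ⬝ᵥ w = 0 := by rw [h0, zero_dotProduct]
    rw [add_dotProduct, smul_dotProduct, hdw, h.1] at h1
    simp at h1
  obtain ⟨u', hu', hact, -⟩ := max_of_subset h hu0 (by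
    intro i hi
    rw [hdot]
    rcases le_or_gt 0 (d ⬝ᵥ x i) with h1 | h1
    · have := mem_capS.mp hi; positivity
    · have := hmin i (Finset.mem_filter.mpr ⟨hi, h1⟩)
      rw [le_div_iff₀ (by linarith)] at this
      linarith)
  have hlt : actS x w 0 ⊂ actS x (w + s • d) 0 := by
    rw [Finset.ssubset_iff_of_subset]
    · refine ⟨i0, mem_actS.mpr ?_, fun h1 => ?_⟩
      · have h2 : -(d ⬝ᵥ x i0) ≠ 0 := by linarith [hi0.2]
        have : s * (-(d ⬝ᵥ x i0)) = w ⬝ᵥ x i0 := div_mul_cancel₀ _ h2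
        rw [hdot]; linarith
      · linarith [hda i0 h1, hi0.2]
    · intro i hi
      rw [mem_actS, hdot, mem_actS.mp hi, hda i hi]; simp
  have h1 := Finset.card_lt_card hlt
  have h2 := hmax u' hu'
  rw [← hact] at h2
  omega

lemma dichotomy {n N : ℕ} (hN : 0 < N) (x : Fin N → (Fin n → ℝ))
    {w : Fin n → ℝ} (h : IsMx x w 0)
    (hmax : ∀ w', IsMx x w' 0 → (actS x w' 0).card ≤ (actS x w 0).card) :
    (∀ d : Fin n → ℝ, (∀ i ∈ actS x w 0, d ⬝ᵥ x i = 0) → d ⬝ᵥ w = 0 → d = 0) ∨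
      actS x w 0 = Finset.univ := by
  by_contra hcon
  push Not at hcon
  obtain ⟨⟨d, hda, hdw, hd0⟩, hne⟩ := hcon
  apply hne
  have h1 := dichotomy_aux x h hmax hda hdw
  have h2 := dichotomy_aux x h hmax (d := -d) (fun i hi => by rw [neg_dotProduct, hda i hi, neg_zero])
    (by rw [neg_dotProduct, hdw, neg_zero])
  obtain ⟨u', hu', hact, -⟩ := max_of_subset h hd0 h1
  have hsub : capS x w 0 ⊆ actS x d 0 := fun i hi => mem_actS.mpr (by
    have := h2 i hi; rw [neg_dotProduct] at this; linarith [h1 i hi])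
  have hc := hmax u' hu'
  rw [← hact] at hc
  have hAJ : actS x w 0 = capS x w 0 :=
    Finset.eq_of_subset_of_card_le (act_sub_cap x w 0) ((Finset.card_le_card hsub).trans hc)
  rw [Finset.eq_univ_iff_forall]
  intro i
  rw [hAJ]
  by_contra hi
  have hneg : capS x w 0 ⊂ capS x (-w) 0 := by
    rw [Finset.ssubset_iff_of_subset]
    · refine ⟨i, ?_, hi⟩
      rw [mem_capS] at hi ⊢
      rw [neg_dotProduct]; linarith
    · intro k hk
      rw [← hAJ, mem_actS] at hk
      rw [mem_capS, neg_dotProduct, hk, neg_zero]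
  have h3 := h.2.2 (-w) 0 (by simpa using h.1) h.2.1
  have h4 : ((capS x w 0).card : ℝ) < (capS x (-w) 0).card := by
    exact_mod_cast Finset.card_lt_card hneg
  have hN' : (0:ℝ) < N := by exact_mod_cast hN
  have h5 := div_lt_div_of_pos_right h4 hN'
  unfold FF at h3
  rw [muEmp_eq, muEmp_eq] at h3
  linarith

lemma case_zero {n N : ℕ} (hN : 0 < N) (x : Fin N → (Fin n → ℝ)) (hx : ∀ i, x i ⬝ᵥ x i = 1)
    {w1 : Fin n → ℝ} (hw1 : IsMx x w1 0) :
    ∃ w, IsMx x w 0 ∧ ∃ I ∈ Phi0 x, ∀ u : Fin n → ℝ, (∀ i ∈ I, u ⬝ᵥ x i = 0) → u ⬝ᵥ u = 1 →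
      FF x w 0 ≤ FF x u 0 ∨ FF x w 0 ≤ FF x (-u) 0 := by
  obtain ⟨w, h, hmax⟩ : ∃ w, IsMx x w 0 ∧
      ∀ w', IsMx x w' 0 → (actS x w' 0).card ≤ (actS x w 0).card := by
    have hfin : (Set.range fun w : {w // IsMx x w 0} => (actS x w.1 0).card).Finite := by
      refine (Set.finite_Iic N).subset ?_
      rintro _ ⟨w, rfl⟩
      simpa using Finset.card_le_univ (actS x w.1 0)
    have hne : (Set.range fun w : {w // IsMx x w 0} => (actS x w.1 0).card).Nonempty :=
      ⟨_, ⟨⟨w1, hw1⟩, rfl⟩⟩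
    obtain ⟨_, ⟨⟨w, hw⟩, rfl⟩, hm⟩ := Set.exists_max_image _ id hfin hne
    exact ⟨w, hw, fun w' hw' => hm _ ⟨⟨w', hw'⟩, rfl⟩⟩
  refine ⟨w, h, ?_⟩
  obtain ⟨I, hIA, hli, hsel⟩ := select x (actS x w 0)
  have hact : ∀ i ∈ I, w ⬝ᵥ x i = 0 := fun i hi => mem_actS.mp (hIA hi)
  have hnov : ∀ v : Fin n → ℝ, (∀ i ∈ I, v ⬝ᵥ x i = 1) → False := fun v hv =>
    no_v hN x hx h v (sel_dot hsel hv)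
  have hne : I.Nonempty := by
    by_contra hne
    rw [Finset.not_nonempty_iff_eq_empty] at hne
    exact hnov 0 (by simp [hne])
  have hrank := (rank_eq_card_iff x I).mpr hli
  have hn : (XtI x I).rank ≤ n := rank_le_n x I (snoc_ne_zero h.1 0) (by
    intro i hi; rw [snoc_dot_xt, hact i hi, sub_self])
  have hg : gammaI x I = 1 := by
    by_contra hg
    refine hnov ((1 - gammaI x I)⁻¹ • yI x I) fun i hi => ?_
    rw [smul_dotProduct, yI_dot x I hli i hi, smul_eq_mul]
    exact inv_mul_cancel₀ (sub_ne_zero.mpr (Ne.symm hg))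
  have hpos : 1 ≤ (XtI x I).rank := by rw [hrank]; exact Finset.card_pos.mpr hne
  rcases dichotomy hN x h hmax with ha | hb
  · have hmul : ∀ u : Fin n → ℝ, (∀ i ∈ I, u ⬝ᵥ x i = 0) → u = (u ⬝ᵥ w) • w := by
      intro u hu
      have hu' := sel_dot hsel hu
      rw [← sub_eq_zero]
      refine ha _ (fun i hi => ?_) ?_
      · rw [sub_dotProduct, smul_dotProduct, hu' i hi, mem_actS.mp hi]; simp
      · rw [sub_dotProduct, smul_dotProduct, h.1]; simp
    have hn2 : n ≤ (XtI x I).rank := by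
      refine n_le_rank x I (Fin.snoc w 0) fun v hv => ?_
      have hv' : ∀ i ∈ I, (Fin.init v) ⬝ᵥ x i = v (Fin.last n) := by
        intro i hi
        have := hv i hi
        rw [← Fin.snoc_init_self v, snoc_dot_xt] at this
        linarith
      have hl : v (Fin.last n) = 0 := by
        by_contra hl
        refine hnov ((v (Fin.last n))⁻¹ • Fin.init v) fun i hi => ?_
        rw [smul_dotProduct, hv' i hi, smul_eq_mul, inv_mul_cancel₀ hl]
      rw [hl] at hv'
      refine ⟨(Fin.init v) ⬝ᵥ w, ?_⟩
      have h1 := hmul _ hv'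
      ext j
      refine Fin.lastCases ?_ (fun j => ?_) j
      · simp [hl]
      · have := congrFun h1 j
        simpa [Fin.init] using this
    refine ⟨I, ⟨hpos, hrank, ?_, hg⟩, ?_⟩
    · have := rank_le_univ x I
      rw [← hrank, min_eq_left] <;> omega
    · intro u hu huu
      have h1 := hmul u hu
      have h2 : (u ⬝ᵥ w) * (u ⬝ᵥ w) = 1 := by
        have h3 : u ⬝ᵥ u = (u ⬝ᵥ w) * (u ⬝ᵥ w) := by
          conv_lhs => rw [h1]
          rw [dotProduct_smul, smul_dotProduct, h.1]; simp
        rw [← h3, huu]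
      rcases mul_self_eq_one_iff.mp h2 with h3 | h3
      · left; rw [h3, one_smul] at h1; rw [h1]
      · right; rw [h3] at h1; rw [h1]; simp
  · refine ⟨I, ⟨hpos, hrank, ?_, hg⟩, ?_⟩
    · have h1 : (XtI x Finset.univ).rank ≤ (XtI x I).rank := by
        rw [rank_XtI, rank_XtI]
        refine Submodule.finrank_mono (Submodule.span_le.mpr ?_)
        rw [← hb]; exact hsel
      have := rank_le_univ x I
      rw [← hrank]
      rw [min_eq_right] <;> omega
    · intro u hu huu
      left
      refine FF_mono x fun i _ => mem_capS.mpr (sel_dot hsel hu i ?_).ge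
      rw [hb]; exact Finset.mem_univ i

theorem statement18 {n N : ℕ} (hn : 2 ≤ n) (hN : 0 < N)
    (x : Fin N → (Fin n → ℝ)) (hx : ∀ i, ∑ j, x i j ^ 2 = 1)
    (w0 : Finset (Fin N) → (Fin n → ℝ))
    (hw0 : ∀ I ∈ Phi0 x, (∀ i ∈ I, ∑ j, w0 I j * x i j = 0) ∧ ∑ j, w0 I j ^ 2 = 1) :
    capDisc x = max (Delta1 x) (Delta0 x w0) := by
  have hsq : ∀ w : Fin n → ℝ, ∑ j, w j ^ 2 = w ⬝ᵥ w := fun w => by simp [dotProduct, sq]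
  have hx' : ∀ i, x i ⬝ᵥ x i = 1 := fun i => by rw [← hsq, hx i]
  have hw0' : ∀ I ∈ Phi0 x, w0 I ⬝ᵥ w0 I = 1 := fun I hI => by rw [← hsq, (hw0 I hI).2]
  obtain ⟨w, t, h⟩ := exists_max hN x hx'
  have hpos := max_pos hN x hx' h
  have hcap : capDisc x = FF x w t := by
    unfold capDisc
    refine le_antisymm (csSup_le ⟨_, w, t, by rw [hsq, h.1], h.2.1, rfl⟩ ?_) ?_
    · rintro _ ⟨w', t', h1, h2, rfl⟩
      exact locDisc_le_of_max hN x h (by rw [← hsq, h1]) h2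
    · refine (FF_le_locDisc x w t).trans (le_csSup ⟨1, ?_⟩ ⟨w, t, by rw [hsq, h.1], h.2.1, rfl⟩)
      rintro _ ⟨w', t', h1, h2, rfl⟩
      exact locDisc_le_one hN x w' t'
  have hneg : ∀ u : Fin n → ℝ, u ⬝ᵥ u = 1 → (-u) ⬝ᵥ (-u) = 1 := fun u hu => by simpa using hu
  rw [hcap]
  apply le_antisymm
  · by_cases ht : t = 0
    · subst ht
      obtain ⟨w2, h2, I, hI, hu⟩ := case_zero hN x hx' h
      refine le_max_of_le_right ?_
      have hle : FF x w 0 ≤ max (locDisc x (w0 I) 0) (locDisc x (-(w0 I)) 0) := by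
        refine (h2.2.2 w 0 h.1 h.2.1).trans ?_
        rcases hu (w0 I) (hw0 I hI).1 (hw0' I hI) with h3 | h3
        · exact le_max_of_le_left (h3.trans (FF_le_locDisc _ _ _))
        · exact le_max_of_le_right (h3.trans (FF_le_locDisc _ _ _))
      refine hle.trans (le_csSup ⟨1, ?_⟩ ⟨I, hI, rfl⟩)
      rintro _ ⟨I, _, rfl⟩
      exact max_le (locDisc_le_one hN x _ _) (locDisc_le_one hN x _ _)
    · obtain ⟨I, hI, hu⟩ := case_ne hN x hx' h ht
      refine le_max_of_le_left ?_
      have hle : FF x w t ≤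
          max (locDisc x (wI x I) (tI x I)) (locDisc x (-(wI x I)) (-(tI x I))) := by
        rcases hu with ⟨h3, h4⟩ | ⟨h3, h4⟩
        · refine le_max_of_le_left ?_
          rw [h3, h4]; exact FF_le_locDisc _ _ _
        · refine le_max_of_le_right ?_
          rw [h3, h4]; exact FF_le_locDisc _ _ _
      refine hle.trans (le_csSup ⟨1, ?_⟩ ⟨I, hI, rfl⟩)
      rintro _ ⟨I, _, rfl⟩
      exact max_le (locDisc_le_one hN x _ _) (locDisc_le_one hN x _ _)
  · refine max_le (Real.sSup_le ?_ hpos.le) (Real.sSup_le ?_ hpos.le)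
    · rintro _ ⟨I, hI, rfl⟩
      obtain ⟨h1, h2, h3, h4⟩ := hI
      have hne : I.Nonempty := Finset.card_pos.mp (by omega)
      obtain ⟨hu, ht⟩ := wI_unit x hx' I ((rank_eq_card_iff x I).mp h2) hne h4
      exact max_le (locDisc_le_of_max hN x h hu ht)
        (locDisc_le_of_max hN x h (hneg _ hu) ⟨by linarith [ht.2], by linarith [ht.1]⟩)
    · rintro _ ⟨I, hI, rfl⟩
      have hu := hw0' I hI
      exact max_le (locDisc_le_of_max hN x h hu (by norm_num))
        (locDisc_le_of_max hN x h (hneg _ hu) (by norm_num))
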